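/- For every s ≥ 1, the family (det A[F]), indexed by the finite subsets F of (ℕ_{>0})^n of cardinality s, is summable in K, and its sum ℓ^{(m)}_s := Σ_{F ⊂ (ℕ_{>0})^n, #F = s} det A[F] satisfies ‖ℓ^{(m)}_s‖ ≤ p^{−m·s·δ_p(D)}. (These ℓ^{(m)}_s are the coefficients of the Fredholm determinant det(I − T·A(Γ)), which therefore lies in the ring M_{δ_p(D)}.) -/

import Mathlib

open scoped BigOperators
open scoped Classical

/-- `sp p u` is the sum of the base-`p` digits of `u`. -/
def sp (p u : ℕ) : ℕ := (Nat.digits p u).sum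

variable {ι : Type} [Fintype ι]

/-- The coordinatewise sum `Σ_{d ∈ D} u_d · d`. -/
def sigmaSum (D : Finset (ι → ℕ)) (U : D → ℕ) (k : ι) : ℕ :=
  ∑ d, U d * (d : ι → ℕ) k

/-- Membership in the set `E_{D,p}(r)`. -/
def memE (p : ℕ) (D : Finset (ι → ℕ)) (r : ℕ) (U : D → ℕ) : Prop :=
  (∀ d, U d ≤ p ^ r - 1) ∧
  (∀ k, (p ^ r - 1) ∣ sigmaSum D U k ∧ 0 < sigmaSum D U k)

/-- The `p`-weight `s_p(U)` of a tuple `U`. -/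
def spU (p : ℕ) (D : Finset (ι → ℕ)) (U : D → ℕ) : ℕ := ∑ d, sp p (U d)

/-- `s_{D,p}(r)`, the minimal `p`-weight of an element of `E_{D,p}(r)`. -/
noncomputable def sDp (p : ℕ) (D : Finset (ι → ℕ)) (r : ℕ) : ℕ :=
  sInf { s | ∃ U : D → ℕ, memE p D r U ∧ spU p D U = s }

/-- The `p`-density `δ_p(D)` of the set `D`. -/
noncomputable def density (p : ℕ) (D : Finset (ι → ℕ)) : ℝ :=
  (1 / ((p : ℝ) - 1)) * sInf { x : ℝ | ∃ r : ℕ, 1 ≤ r ∧ x = (sDp p D r : ℝ) / (r : ℝ) }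

/-- A minimal solution in `E_{D,p}(r)`. -/
def minimalSol (p : ℕ) (D : Finset (ι → ℕ)) (r : ℕ) (U : D → ℕ) : Prop :=
  memE p D r U ∧ (spU p D U : ℝ) = ((p : ℝ) - 1) * (r : ℝ) * density p D

/-- `φ_r(U) = (1/(p^r − 1)) Σ_{d ∈ D} u_d · d`. -/
def phiMap (p : ℕ) (D : Finset (ι → ℕ)) (r : ℕ) (U : D → ℕ) (k : ι) : ℕ :=
  sigmaSum D U k / (p ^ r - 1)

/-- The shift `δ_r` on `{0, …, p^r − 1}`. -/
def shiftFun (p r u : ℕ) : ℕ := if u = p ^ r - 1 then u else (p * u) % (p ^ r - 1)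

/-- The componentwise action of the shift `δ_r` on tuples. -/
def shiftE (p : ℕ) (D : Finset (ι → ℕ)) (r : ℕ) (U : D → ℕ) : D → ℕ :=
  fun d => shiftFun p r (U d)

/-- The support `φ_U : ℤ/rℤ → ℕ^n` of a solution `U ∈ E_{D,p}(r)`. -/
def suppMap (p : ℕ) (D : Finset (ι → ℕ)) (r : ℕ) (U : D → ℕ) (k : ZMod r) : ι → ℕ :=
  phiMap p D r ((shiftE p D r)^[k.val] U)

/-- Membership in `MI_{D,p}(r)`: minimal irreducible solutions. -/
def memMI (p : ℕ) (D : Finset (ι → ℕ)) (r : ℕ) (U : D → ℕ) : Prop :=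
  minimalSol p D r U ∧ Function.Injective (suppMap p D r U)

/-- The `p`-minimal support `Σ_p(D)`. -/
def minSupport (p : ℕ) (D : Finset (ι → ℕ)) : Set (ι → ℕ) :=
  { e | ∃ r : ℕ, 1 ≤ r ∧ ∃ U : D → ℕ, memMI p D r U ∧ e ∈ Set.range (suppMap p D r U) }

/-- `ψ(U)`: the tuple of last base-`p` digits of `U`. -/
def psiMap (p : ℕ) (D : Finset (ι → ℕ)) (U : D → ℕ) : D → ℕ := fun d => U d % p

/-- The set `V(e, e')` of digit tuples of minimal irreducible solutions with
`φ_U(−1) = e` and `φ_U(0) = e'`. -/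
def Vset (p : ℕ) (D : Finset (ι → ℕ)) (e e' : ι → ℕ) : Set (D → ℕ) :=
  { v | ∃ r : ℕ, 1 ≤ r ∧ ∃ U : D → ℕ, memMI p D r U ∧
      suppMap p D r U (-1) = e ∧ suppMap p D r U 0 = e' ∧ psiMap p D U = v }

/-- The weight `w(V) = Σ_{d ∈ D} v_d`. -/
def weightV (D : Finset (ι → ℕ)) (v : D → ℕ) : ℕ := ∑ d, v d

/-- The coefficient `λ^{(m)}_u = Σ_{r+q·s=u} (−1)^s π^{r+s}/(r!·s!)` of the
splitting function `θ_m(X) = exp(πX − πX^q)`, where `q = p^m`. -/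
noncomputable def lam {K : Type} [Field K] (p m : ℕ) (π : K) (u : ℕ) : K :=
  ∑ s ∈ Finset.range (u / p ^ m + 1),
    (-1 : K) ^ s * π ^ (u - p ^ m * s + s) /
      (((u - p ^ m * s).factorial : K) * (s.factorial : K))

/-- The coefficient `f^{(m)}_i(Γ) = Σ_{Σ_d u_d·d = i} Π_d λ^{(m)}_{u_d} γ_d^{u_d}`
of the series `F_m(Γ, X)`.  (Since `0 ∉ D`, any solution of `Σ_d u_d·d = i`
satisfies `u_d ≤ Σ_k i_k` for every `d`, so the sum below ranges over all
solutions.) -/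
noncomputable def fcoef {K : Type} [Field K] {ι : Type} [Fintype ι]
    (p m : ℕ) (π : K) (D : Finset (ι → ℕ)) (γ : D → K) (i : ι → ℕ) : K :=
  ∑ u ∈ (Fintype.piFinset fun _ : D => Finset.range ((∑ k, i k) + 1)) |>.filter
      (fun u : D → ℕ => ∀ k, sigmaSum D u k = i k),
    ∏ d, lam p m π (u d) * γ d ^ u d

/-- `f^{(m)}_i(Γ)` for `i ∈ ℤ^n`: it is `0` whenever `i` has a negative
coordinate. -/
noncomputable def fcoefZ {K : Type} [Field K] {ι : Type} [Fintype ι]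
    (p m : ℕ) (π : K) (D : Finset (ι → ℕ)) (γ : D → K) (i : ι → ℤ) : K :=
  if ∀ k, 0 ≤ i k then fcoef p m π D γ (fun k => (i k).toNat) else 0

section DigitSums

theorem sp_rec (p : ℕ) (hp : p.Prime) (a c : ℕ) (hc : c < p) : sp p (c + p * a) = c + sp p a := by
  unfold sp
  by_cases h : c ≠ 0 ∨ a ≠ 0
  · rw [Nat.digits_add p hp.one_lt c a hc h]; simp
  · push Not at h
    simp [h.1, h.2]

theorem sp_append (p : ℕ) (hp : p.Prime) (N : ℕ) : ∀ a b : ℕ, b < p ^ N →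
    sp p (b + p ^ N * a) = sp p b + sp p a := by
  induction N with
  | zero => intro a b hb; simp at hb; subst hb; simp [sp]
  | succ N ih =>
    intro a b hb
    have hb' : b / p < p ^ N := by
      rw [Nat.div_lt_iff_lt_mul hp.pos]; rwa [pow_succ] at hb
    have e1 : b + p ^ (N+1) * a = b % p + p * (b / p + p ^ N * a) := by
      conv_lhs => rw [← Nat.mod_add_div b p]
      ring
    rw [e1, sp_rec p hp _ _ (Nat.mod_lt _ hp.pos), ih _ _ hb']
    conv_rhs => rw [← Nat.mod_add_div b p, sp_rec p hp _ _ (Nat.mod_lt _ hp.pos)]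
    ring

theorem sp_mul_pow (p : ℕ) (hp : p.Prime) (N a : ℕ) : sp p (p ^ N * a) = sp p a := by
  have := sp_append p hp N a 0 (pow_pos hp.pos N)
  simpa [sp] using this

theorem sp_legendre (p : ℕ) (hp : p.Prime) (n : ℕ) :
    (p - 1) * padicValNat p n.factorial + sp p n = n := by
  have := Fact.mk hp
  have h := sub_one_mul_padicValNat_factorial (p := p) n
  have h2 := Nat.digit_sum_le p n
  rw [h]; unfold sp; omega

theorem sp_add_le (p : ℕ) (hp : p.Prime) (a b : ℕ) : sp p (a + b) ≤ sp p a + sp p b := by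
  have := Fact.mk hp
  have h1 := sp_legendre p hp a
  have h2 := sp_legendre p hp b
  have h3 := sp_legendre p hp (a + b)
  have h4 : padicValNat p a.factorial + padicValNat p b.factorial
      ≤ padicValNat p (a+b).factorial := by
    rw [← padicValNat.mul (Nat.factorial_ne_zero _) (Nat.factorial_ne_zero _)]
    exact (padicValNat_dvd_iff_le (Nat.factorial_ne_zero _)).1
      (pow_padicValNat_dvd.trans (Nat.factorial_mul_factorial_dvd_factorial_add a b))
  have h5 := Nat.mul_le_mul_left (p - 1) h4
  rw [mul_add] at h5
  omega

theorem sp_sum_le (p : ℕ) (hp : p.Prime) {α : Type*} (s : Finset α) (f : α → ℕ) :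
    sp p (∑ i ∈ s, f i) ≤ ∑ i ∈ s, sp p (f i) := by
  induction s using Finset.induction_on with
  | empty => simp [sp]
  | insert a s ha ih =>
    rw [Finset.sum_insert ha, Finset.sum_insert ha]
    exact (sp_add_le p hp _ _).trans (by omega)

theorem sp_pos (p : ℕ) (hp : p.Prime) (n : ℕ) (hn : 0 < n) : 1 ≤ sp p n := by
  have := Fact.mk hp
  have := sub_one_mul_padicValNat_factorial_lt_of_ne_zero p (n := n) hn.ne'
  have h3 := sp_legendre p hp n
  omega

/-- reduction modulo `p^N - 1`. -/
theorem exists_reduce (p : ℕ) (hp : p.Prime) (N : ℕ) (hN : 1 ≤ N) (W : ℕ) :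
    ∃ W' : ℕ, W' ≤ p ^ N - 1 ∧ (p ^ N - 1) ∣ W - W' ∧ W' ≤ W ∧ (0 < W → 0 < W') ∧
      sp p W' ≤ sp p W := by
  induction W using Nat.strong_induction_on with
  | _ W ih =>
    have hq : 1 < p ^ N := Nat.one_lt_pow (by omega) hp.one_lt
    by_cases h : W ≤ p ^ N - 1
    · exact ⟨W, h, by simp, le_rfl, id, le_rfl⟩
    · push Not at h
      have hW : W % p ^ N + p ^ N * (W / p ^ N) = W := Nat.mod_add_div _ _
      set a := W / p ^ N with ha
      set b := W % p ^ N with hb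
      have ha1 : 1 ≤ a := Nat.div_pos (by omega) (by omega)
      have hblt : b < p ^ N := Nat.mod_lt _ (by omega)
      clear_value a b
      clear ha hb
      obtain ⟨Q, hQ⟩ : ∃ Q, p ^ N = Q + 1 := ⟨p ^ N - 1, by omega⟩
      have hQ1 : 1 ≤ Q := by omega
      have hWe : W = b + a + Q * a := by rw [← hW, hQ]; ring
      have hQa : 1 ≤ Q * a := Nat.mul_pos hQ1 ha1
      obtain ⟨W', h1, h2, h3, h4, h5⟩ := ih (b + a) (by omega)
      refine ⟨W', h1, ?_, by omega, fun _ => h4 (by omega), ?_⟩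
      · have : W - W' = (b + a - W') + Q * a := by omega
        rw [this]
        refine dvd_add h2 ?_
        rw [hQ]; simp
      · refine h5.trans ((sp_add_le p hp _ _).trans ?_)
        rw [← sp_append p hp N a b hblt, hW]

end DigitSums

section Combin

theorem sp_density {ι : Type} [Fintype ι] (p : ℕ) (hp : p.Prime) (D : Finset (ι → ℕ)) (r : ℕ)
    (hr : 1 ≤ r) (U : D → ℕ) (hU : memE p D r U) :
    ((p : ℝ) - 1) * r * density p D ≤ spU p D U := by
  have h1 : sDp p D r ≤ spU p D U := Nat.sInf_le ⟨U, hU, rfl⟩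
  have hp1 : (0 : ℝ) < (p : ℝ) - 1 := by
    have : (1 : ℝ) < p := by exact_mod_cast hp.one_lt
    linarith
  have hr0 : (0 : ℝ) < r := by exact_mod_cast hr
  have h2 : sInf { x : ℝ | ∃ r : ℕ, 1 ≤ r ∧ x = (sDp p D r : ℝ) / (r : ℝ) }
      ≤ (sDp p D r : ℝ) / r := by
    refine csInf_le ⟨0, ?_⟩ ⟨r, hr, rfl⟩
    rintro x ⟨r, _, rfl⟩
    positivity
  have h3 : ((p : ℝ) - 1) * r * density p D = r * sInf { x : ℝ | ∃ r : ℕ, 1 ≤ r ∧ x = (sDp p D r : ℝ) / (r : ℝ) } := by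
    unfold density; field_simp
  rw [h3]
  calc _ ≤ r * ((sDp p D r : ℝ) / r) := by gcongr
    _ = sDp p D r := by field_simp
    _ ≤ _ := by exact_mod_cast h1

/-- closed walks -/
theorem walk_bound {ι : Type} [Fintype ι] (p m : ℕ) (hp : p.Prime) (hm : 1 ≤ m)
    (D : Finset (ι → ℕ)) (N : ℕ) (hN : 1 ≤ N) (x : ℕ → ι → ℕ) (hx : ∀ k, 0 < x 0 k)
    (hclosed : x N = x 0) (u : ℕ → D → ℕ)
    (hu : ∀ t k, sigmaSum D (u t) k + x t k = p ^ m * x (t + 1) k) :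
    ((p : ℝ) - 1) * (m * N : ℕ) * density p D ≤ ((∑ t ∈ Finset.range N, spU p D (u t) : ℕ) : ℝ) := by
  have hmN : 1 ≤ m * N := Nat.mul_pos hm hN
  set W : D → ℕ := fun d => ∑ t ∈ Finset.range N, p ^ (m * t) * u t d with hW
  have key : ∀ k n, sigmaSum D (fun d => ∑ t ∈ Finset.range n, p ^ (m * t) * u t d) k + x 0 k
      = p ^ (m * n) * x n k := by
    intro k n
    induction n with
    | zero => simp [sigmaSum]
    | succ n ih =>
      have e : sigmaSum D (fun d => ∑ t ∈ Finset.range (n+1), p ^ (m * t) * u t d) k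
        = sigmaSum D (fun d => ∑ t ∈ Finset.range n, p ^ (m * t) * u t d) k
          + p ^ (m * n) * sigmaSum D (u n) k := by
        unfold sigmaSum
        rw [Finset.mul_sum, ← Finset.sum_add_distrib]
        refine Finset.sum_congr rfl fun d _ => ?_
        simp only [Finset.sum_range_succ]; ring
      have h2 := hu n k
      calc _ = (sigmaSum D (fun d => ∑ t ∈ Finset.range n, p ^ (m * t) * u t d) k + x 0 k)
            + p ^ (m * n) * sigmaSum D (u n) k := by rw [e]; ring
        _ = p ^ (m * n) * (sigmaSum D (u n) k + x n k) := by rw [ih]; ring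
        _ = _ := by rw [h2]; ring
  obtain ⟨Q, hQ⟩ : ∃ Q, p ^ (m * N) = Q + 1 :=
    ⟨p ^ (m * N) - 1, by have := pow_pos hp.pos (m * N); omega⟩
  have hQ1 : 1 ≤ Q := by
    have : 1 < p ^ (m * N) := Nat.one_lt_pow (by omega) hp.one_lt
    omega
  have hsW : ∀ k, sigmaSum D W k = Q * x 0 k := by
    intro k
    have := key k N
    rw [hclosed, hQ, add_mul, one_mul] at this
    exact Nat.add_right_cancel this
  choose W' h1 h2 h3 h4 h5 using fun d => exists_reduce p hp (m * N) hmN (W d)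
  have hmem : memE p D (m * N) W' := by
    refine ⟨h1, fun k => ⟨?_, ?_⟩⟩
    · have e : sigmaSum D W k = sigmaSum D W' k + sigmaSum D (fun d => W d - W' d) k := by
        unfold sigmaSum
        rw [← Finset.sum_add_distrib]
        refine Finset.sum_congr rfl fun d _ => ?_
        rw [← add_mul]
        congr 1
        have := h3 d
        simp only
        omega
      have d1 : (p ^ (m * N) - 1) ∣ sigmaSum D W k := by rw [hsW, hQ]; simp
      have d2 : (p ^ (m * N) - 1) ∣ sigmaSum D (fun d => W d - W' d) k :=
        Finset.dvd_sum fun d _ => (h2 d).mul_right _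
      rw [e] at d1
      exact (Nat.dvd_add_left d2).1 d1
    · have : 0 < sigmaSum D W k := by rw [hsW]; exact Nat.mul_pos hQ1 (hx k)
      obtain ⟨d, hd, hd0⟩ : ∃ d ∈ (Finset.univ : Finset D), W d * (d : ι → ℕ) k ≠ 0 :=
        Finset.exists_ne_zero_of_sum_ne_zero this.ne'
      have hWd : 0 < W d := Nat.pos_of_ne_zero (left_ne_zero_of_mul hd0)
      have hdk : 0 < (d : ι → ℕ) k := Nat.pos_of_ne_zero (right_ne_zero_of_mul hd0)
      refine Finset.sum_pos' (fun _ _ => Nat.zero_le _) ⟨d, hd, Nat.mul_pos (h4 d hWd) hdk⟩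
  refine (sp_density p hp D _ hmN W' hmem).trans ?_
  have : spU p D W' ≤ ∑ t ∈ Finset.range N, spU p D (u t) := by
    unfold spU
    rw [Finset.sum_comm]
    refine Finset.sum_le_sum fun d _ => (h5 d).trans ?_
    refine (sp_sum_le p hp _ _).trans ?_
    refine Finset.sum_le_sum fun t _ => ?_
    rw [sp_mul_pow p hp]
  exact_mod_cast this

/-- weights along a permutation -/
theorem perm_bound {ι : Type} [Fintype ι] (p m : ℕ) (hp : p.Prime) (hm : 1 ≤ m)
    (D : Finset (ι → ℕ)) {α : Type} [Fintype α] [DecidableEq α] (x : α → ι → ℕ)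
    (hx : ∀ i k, 0 < x i k) (σ : Equiv.Perm α) (u : α → D → ℕ)
    (hu : ∀ i k, sigmaSum D (u i) k + x i k = p ^ m * x (σ i) k) :
    ((p : ℝ) - 1) * m * Fintype.card α * density p D ≤ ((∑ i, spU p D (u i) : ℕ) : ℝ) := by
  set N := orderOf σ with hN
  have hN1 : 1 ≤ N := orderOf_pos σ
  have hσ : σ ^ N = 1 := pow_orderOf_eq_one σ
  have h1 : ∀ i, ((p : ℝ) - 1) * (m * N : ℕ) * density p D ≤
      ((∑ t ∈ Finset.range N, spU p D (u ((σ ^ t) i)) : ℕ) : ℝ) := by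
    intro i
    refine walk_bound p m hp hm D N hN1 (fun t => x ((σ ^ t) i)) ?_ ?_ (fun t => u ((σ ^ t) i)) ?_
    · intro k; exact hx _ _
    · simp [hσ]
    · intro t k
      simp only [pow_succ']
      exact hu _ k
  have h2 := Finset.sum_le_sum (s := Finset.univ) fun i _ => h1 i
  have h3 : ∑ i, ∑ t ∈ Finset.range N, spU p D (u ((σ ^ t) i)) = N * ∑ i, spU p D (u i) := by
    rw [Finset.sum_comm]
    rw [Finset.sum_congr rfl fun t _ => Equiv.sum_comp (σ ^ t) (fun i => spU p D (u i))]
    simp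
  rw [← Nat.cast_sum, h3] at h2
  simp only [Finset.sum_const, Finset.card_univ, nsmul_eq_mul] at h2
  push_cast at h2 ⊢
  have hN0 : (0 : ℝ) < N := by exact_mod_cast hN1
  refine le_of_mul_le_mul_left ?_ hN0
  linarith

end Combin
section Norms

variable {K : Type} [NormedField K] [CharZero K]

theorem norm_prime_eq (p : ℕ) (π : K) (hπ : π ^ (p - 1) = -(p : K)) : ‖(p : K)‖ = ‖π‖ ^ (p - 1) := by
  rw [← norm_pow, hπ, norm_neg]

theorem pi_pos (p : ℕ) (hp : p.Prime) (π : K) (hπ : π ^ (p - 1) = -(p : K)) : 0 < ‖π‖ := by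
  rw [norm_pos_iff]
  rintro rfl
  have h2 := hp.two_le
  rw [zero_pow (by omega), eq_comm, neg_eq_zero] at hπ
  exact hp.ne_zero (by exact_mod_cast hπ)

theorem pi_lt_one (p : ℕ) (hp : p.Prime) (hpnorm : ‖(p : K)‖ = (p : ℝ)⁻¹)
    (π : K) (hπ : π ^ (p - 1) = -(p : K)) : ‖π‖ < 1 := by
  by_contra h
  push Not at h
  have h1 := one_le_pow₀ h (n := p - 1)
  rw [← norm_prime_eq p π hπ, hpnorm] at h1
  have : (1 : ℝ) < p := by exact_mod_cast hp.one_lt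
  exact absurd (inv_lt_one_of_one_lt₀ this) (not_lt.2 h1)

theorem norm_coprime (hna : IsUltrametricDist K) (p : ℕ) (hp : p.Prime) (hlt : ‖(p : K)‖ < 1)
    (n : ℕ) (hn : ¬ p ∣ n) : ‖(n : K)‖ = 1 := by
  refine le_antisymm (IsUltrametricDist.norm_natCast_le_one K n) ?_
  by_contra h
  push Not at h
  have hc : IsCoprime (n : ℤ) (p : ℤ) := by
    rw [Nat.isCoprime_iff_coprime]
    exact ((Nat.Prime.coprime_iff_not_dvd hp).2 hn).symm
  obtain ⟨a, b, hab⟩ := hc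
  have hab' : (a : K) * n + b * p = 1 := by exact_mod_cast congrArg (Int.cast : ℤ → K) hab
  have ha := IsUltrametricDist.norm_intCast_le_one K a
  have hb := IsUltrametricDist.norm_intCast_le_one K b
  have : ‖(a : K) * n + b * p‖ < 1 := by
    refine (IsUltrametricDist.norm_add_le_max _ _).trans_lt (max_lt ?_ ?_)
    · rw [norm_mul]; exact mul_lt_one_of_nonneg_of_lt_one_right ha (norm_nonneg _) h
    · rw [norm_mul]; exact mul_lt_one_of_nonneg_of_lt_one_right hb (norm_nonneg _) hlt
  rw [hab', norm_one] at this
  exact lt_irrefl _ this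

theorem norm_factorial (hna : IsUltrametricDist K) (p : ℕ) (hp : p.Prime)
    (hpnorm : ‖(p : K)‖ = (p : ℝ)⁻¹) (π : K) (hπ : π ^ (p - 1) = -(p : K)) (n : ℕ) :
    ‖(n.factorial : K)‖ * ‖π‖ ^ sp p n = ‖π‖ ^ n := by
  have := Fact.mk hp
  have hlt : ‖(p : K)‖ < 1 := by
    rw [hpnorm]; exact inv_lt_one_of_one_lt₀ (by exact_mod_cast hp.one_lt)
  obtain ⟨w, hw⟩ := pow_padicValNat_dvd (p := p) (n := n.factorial)
  have hw' : ¬ p ∣ w := by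
    rintro ⟨c, rfl⟩
    refine pow_succ_padicValNat_not_dvd (p := p) (Nat.factorial_ne_zero n) ⟨c, ?_⟩
    conv_lhs => rw [hw]
    ring
  have e : ‖(n.factorial : K)‖ = ‖π‖ ^ ((p - 1) * padicValNat p n.factorial) := by
    conv_lhs => rw [hw]
    push_cast
    rw [norm_mul, norm_coprime hna p hp hlt w hw', mul_one, norm_pow, norm_prime_eq p π hπ, ← pow_mul]
  rw [e, ← pow_add, sp_legendre p hp n]

theorem norm_pi_div_fact (hna : IsUltrametricDist K) (p : ℕ) (hp : p.Prime)
    (hpnorm : ‖(p : K)‖ = (p : ℝ)⁻¹) (π : K) (hπ : π ^ (p - 1) = -(p : K)) (n : ℕ) :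
    ‖π ^ n / (n.factorial : K)‖ = ‖π‖ ^ sp p n := by
  rw [norm_div, norm_pow, ← norm_factorial hna p hp hpnorm π hπ n, mul_comm, mul_div_assoc, div_self,
    mul_one]
  rw [norm_ne_zero_iff]
  exact_mod_cast Nat.factorial_ne_zero n

theorem norm_lam_le (hna : IsUltrametricDist K) (p m : ℕ) (hp : p.Prime)
    (hpnorm : ‖(p : K)‖ = (p : ℝ)⁻¹) (π : K) (hπ : π ^ (p - 1) = -(p : K)) (u : ℕ) :
    ‖lam p m π u‖ ≤ ‖π‖ ^ sp p u := by
  unfold lam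
  refine IsUltrametricDist.norm_sum_le_of_forall_le_of_nonneg (by positivity) fun s hs => ?_
  have hs' : p ^ m * s ≤ u := by
    rw [Finset.mem_range] at hs
    calc p ^ m * s ≤ p ^ m * (u / p ^ m) := Nat.mul_le_mul_left _ (by omega)
      _ ≤ u := Nat.mul_div_le _ _
  have e : (-1 : K) ^ s * π ^ (u - p ^ m * s + s) /
      (((u - p ^ m * s).factorial : K) * (s.factorial : K)) =
      (-1 : K) ^ s * ((π ^ (u - p ^ m * s) / ((u - p ^ m * s).factorial : K)) *
        (π ^ s / (s.factorial : K))) := by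
    rw [pow_add]; ring
  rw [e, norm_mul, norm_mul, norm_pi_div_fact hna p hp hpnorm π hπ,
    norm_pi_div_fact hna p hp hpnorm π hπ, norm_pow, norm_neg, norm_one, one_pow, one_mul, ← pow_add]
  refine pow_le_pow_of_le_one (norm_nonneg _) (pi_lt_one p hp hpnorm π hπ).le ?_
  have h1 := sp_add_le p hp (u - p ^ m * s) (p ^ m * s)
  rw [sp_mul_pow p hp, Nat.sub_add_cancel hs'] at h1
  exact h1

end Norms

section Series
open PowerSeries

variable {K : Type} [NormedField K]

/-- all coefficients have norm at most `r` -/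
def Bd (r : ℝ) (f : PowerSeries K) : Prop := ∀ n, ‖coeff n f‖ ≤ r

theorem Bd.mono {r t : ℝ} {f : PowerSeries K} (h : Bd r f) (hrt : r ≤ t) : Bd t f :=
  fun n => (h n).trans hrt

theorem Bd.nonneg {r : ℝ} {f : PowerSeries K} (h : Bd r f) : 0 ≤ r := (norm_nonneg _).trans (h 0)

theorem Bd.add (hna : IsUltrametricDist K) {r : ℝ} {f g : PowerSeries K} (hf : Bd r f)
    (hg : Bd r g) : Bd r (f + g) := by
  intro n
  rw [map_add]
  exact (IsUltrametricDist.norm_add_le_max _ _).trans (max_le (hf n) (hg n))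

theorem Bd.neg {r : ℝ} {f : PowerSeries K} (hf : Bd r f) : Bd r (-f) := by
  intro n
  rw [map_neg, norm_neg]
  exact hf n

theorem Bd.sub (hna : IsUltrametricDist K) {r : ℝ} {f g : PowerSeries K} (hf : Bd r f)
    (hg : Bd r g) : Bd r (f - g) := by
  rw [sub_eq_add_neg]; exact hf.add hna hg.neg

theorem Bd.zero {r : ℝ} (hr : 0 ≤ r) : Bd r (0 : PowerSeries K) := by
  intro n; simpa using hr

theorem Bd.sum (hna : IsUltrametricDist K) {r : ℝ} (hr : 0 ≤ r) {α : Type*} (s : Finset α)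
    (f : α → PowerSeries K) (hf : ∀ i ∈ s, Bd r (f i)) : Bd r (∑ i ∈ s, f i) := by
  intro n
  rw [map_sum]
  exact IsUltrametricDist.norm_sum_le_of_forall_le_of_nonneg hr fun i hi => hf i hi n

theorem Bd.mul (hna : IsUltrametricDist K) {r t : ℝ} {f g : PowerSeries K} (hf : Bd r f)
    (hg : Bd t g) : Bd (r * t) (f * g) := by
  intro n
  rw [coeff_mul]
  refine IsUltrametricDist.norm_sum_le_of_forall_le_of_nonneg (mul_nonneg hf.nonneg hg.nonneg)
    fun x _ => ?_
  rw [norm_mul]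
  exact mul_le_mul (hf _) (hg _) (norm_nonneg _) hf.nonneg

theorem Bd.C (a : K) : Bd ‖a‖ (C a : PowerSeries K) := by
  intro n
  rw [coeff_C]; split_ifs <;> simp

theorem Bd.natCast (n : ℕ) : Bd ‖(n : K)‖ (n : PowerSeries K) := by
  have := Bd.C (n : K)
  rwa [map_natCast] at this

theorem Bd.one : Bd 1 (1 : PowerSeries K) := by
  have := Bd.C (1 : K)
  rwa [map_one, norm_one] at this

theorem Bd.Xpow (k : ℕ) : Bd 1 (X ^ k : PowerSeries K) := by
  intro n
  rw [coeff_X_pow]; split_ifs <;> simp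

theorem Bd.pow (hna : IsUltrametricDist K) {r : ℝ} {f : PowerSeries K} (hf : Bd r f) (k : ℕ) :
    Bd (r ^ k) (f ^ k) := by
  induction k with
  | zero => simpa using Bd.one
  | succ k ih => rw [pow_succ, pow_succ]; exact ih.mul hna hf

theorem Bd.pow_one (hna : IsUltrametricDist K) {f : PowerSeries K} (hf : Bd 1 f) (k : ℕ) :
    Bd 1 (f ^ k) := by simpa using hf.pow hna k

theorem Bd.pow_sub_one (hna : IsUltrametricDist K) {r : ℝ} (hr : r ≤ 1) {f : PowerSeries K}
    (hf : Bd r (f - 1)) (k : ℕ) : Bd r (f ^ k - 1) := by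
  have hf1 : Bd 1 f := by
    have := (hf.mono hr).add hna Bd.one
    simpa using this
  induction k with
  | zero => simpa using Bd.zero hf.nonneg
  | succ k ih =>
    have : f ^ (k + 1) - 1 = (f ^ k - 1) * f + (f - 1) := by ring
    rw [this]
    refine Bd.add hna ?_ hf
    simpa using ih.mul hna hf1

/-- binomial expansion up to second order -/
theorem Bd.binom (hna : IsUltrametricDist K) (p : ℕ) (hp : p.Prime) {ε : ℝ} (hε : ε ≤ 1)
    {c h : PowerSeries K} (hc : Bd 1 c) (hh : Bd ε h) :
    Bd (‖(p : K)‖ * ε ^ 2) ((c + h) ^ p - c ^ p - (p : PowerSeries K) * (h * c ^ (p - 1)) - h ^ p) := by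
  have h0 := hh.nonneg
  have e := add_pow_prime_eq' hp h c
  have e2 : Finset.Ioo 0 p = insert 1 (Finset.Ioo 1 p) := by
    have := hp.two_le
    ext k; simp; omega
  rw [e2, Finset.sum_insert (by simp)] at e
  have e3 : (c + h) ^ p - c ^ p - (p : PowerSeries K) * (h * c ^ (p - 1)) - h ^ p =
      p * ∑ k ∈ Finset.Ioo 1 p, h ^ k * c ^ (p - k) * ((p.choose k / p : ℕ) : PowerSeries K) := by
    rw [add_comm c h, e]
    simp only [Nat.choose_one_right, Nat.div_self hp.pos, Nat.cast_one]
    ring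
  rw [e3]
  refine (Bd.natCast p).mul hna (Bd.sum hna (by positivity) _ _ fun k hk => ?_)
  rw [Finset.mem_Ioo] at hk
  have h1 : Bd (ε ^ 2) (h ^ k) := (hh.pow hna k).mono (pow_le_pow_of_le_one h0 hε (by omega))
  have h2 : Bd 1 ((p.choose k / p : ℕ) : PowerSeries K) :=
    (Bd.natCast _).mono (IsUltrametricDist.norm_natCast_le_one K _)
  simpa using (h1.mul hna (hc.pow_one hna (p - k))).mul hna h2

theorem Bd.trunc_pow (hna : IsUltrametricDist K) {r : ℝ} (hr : 0 ≤ r) (e : PowerSeries K) (n : ℕ)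
    (h : ∀ i < n, ‖coeff i e‖ ≤ r) (k : ℕ) : ∀ j < n, ‖coeff j (e ^ k)‖ ≤ r ^ k := by
  induction k with
  | zero => intro j _; simpa using Bd.one (K := K) j
  | succ k ih =>
    intro j hj
    rw [pow_succ, coeff_mul]
    refine IsUltrametricDist.norm_sum_le_of_forall_le_of_nonneg (by positivity) fun x hx => ?_
    rw [Finset.HasAntidiagonal.mem_antidiagonal] at hx
    rw [norm_mul, pow_succ]
    exact mul_le_mul (ih _ (by omega)) (h _ (by omega)) (norm_nonneg _) (by positivity)

/-- the base step: `p e + e^p` small and `e` without constant term forces `e` small -/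
theorem base_step (hna : IsUltrametricDist K) (p : ℕ) (hp : p.Prime) (hp0 : (p : K) ≠ 0) {r : ℝ}
    (hr : 0 ≤ r)
    (hrp : r ^ p ≤ ‖(p : K)‖ * r) (e : PowerSeries K) (he0 : coeff 0 e = 0)
    (he : Bd (‖(p : K)‖ * r) ((p : PowerSeries K) * e + e ^ p)) : Bd r e := by
  intro n
  induction n using Nat.strong_induction_on with
  | _ n ih =>
    have hpp : 0 < ‖(p : K)‖ := norm_pos_iff.2 hp0
    have h1 : ‖coeff n (e ^ p)‖ ≤ r ^ p := by
      obtain ⟨k, rfl⟩ : ∃ k, p = k + 1 + 1 := ⟨p - 2, by have := hp.two_le; omega⟩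
      rw [pow_succ, coeff_mul]
      refine IsUltrametricDist.norm_sum_le_of_forall_le_of_nonneg (by positivity) fun x hx => ?_
      rw [Finset.HasAntidiagonal.mem_antidiagonal] at hx
      by_cases hx2 : x.2 = 0
      · rw [hx2, he0, mul_zero, norm_zero]; positivity
      by_cases hx1 : x.1 = 0
      · rw [hx1]
        have : coeff 0 (e ^ (k+1)) = 0 := by
          rw [coeff_zero_eq_constantCoeff_apply] at he0 ⊢
          rw [map_pow, he0, zero_pow (by omega)]
        rw [this, zero_mul, norm_zero]; positivity
      rw [norm_mul, pow_succ r]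
      exact mul_le_mul (Bd.trunc_pow hna hr e n (fun i hi => ih i hi) (k+1) _ (by omega))
        (ih _ (by omega)) (norm_nonneg _) (by positivity)
    have h2 := he n
    have h3 : coeff n ((p : PowerSeries K) * e) = p * coeff n e := by
      rw [← map_natCast (PowerSeries.C (R := K)), coeff_C_mul]
    have h4 : (p : K) * coeff n e = coeff n ((p : PowerSeries K) * e + e ^ p) - coeff n (e ^ p) := by
      rw [map_add, h3]; ring
    have h5 : ‖(p : K) * coeff n e‖ ≤ ‖(p : K)‖ * r := by
      rw [h4, sub_eq_add_neg]
      refine (IsUltrametricDist.norm_add_le_max _ _).trans (max_le h2 ?_)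
      rw [norm_neg]; exact h1.trans hrp
    rw [norm_mul] at h5
    exact le_of_mul_le_mul_left h5 hpp

/-- approximable by polynomials up to precision `r` -/
def Ap (r : ℝ) (f : PowerSeries K) : Prop := ∃ c : Polynomial K, Bd r (f - (c : PowerSeries K))

/-- the inductive step -/
theorem ind_step (hna : IsUltrametricDist K) (p : ℕ) (hp : p.Prime) (hp0 : (p : K) ≠ 0) {ϖ ε : ℝ}
    (hϖ : 0 ≤ ϖ) (hϖ1 : ϖ ≤ 1) (hεϖ : ε ≤ ϖ) (hεp : ε ^ p ≤ ‖(p : K)‖ * (ϖ * ε))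
    (θ : PowerSeries K) (hθ : Bd ϖ (θ - 1)) (hG : Ap (‖(p : K)‖ * (ϖ * ε)) (θ ^ p))
    (h : Ap ε θ) : Ap (ϖ * ε) θ := by
  obtain ⟨c, hc⟩ := h
  obtain ⟨G, hG⟩ := hG
  have hε0 := hc.nonneg
  have hε1 : ε ≤ 1 := hεϖ.trans hϖ1
  set h : PowerSeries K := θ - (c : PowerSeries K) with hh
  have hc1 : Bd ϖ ((c : PowerSeries K) - 1) := by
    have : (c : PowerSeries K) - 1 = (θ - 1) - h := by rw [hh]; ring
    rw [this]; exact hθ.sub hna (hc.mono hεϖ)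
  have hcb : Bd 1 (c : PowerSeries K) := by
    have := (hc1.mono hϖ1).add hna Bd.one
    simpa using this
  have b1 := Bd.binom hna p hp hε1 hcb hc
  have b2 := hc1.pow_sub_one hna hϖ1 (p - 1)
  have b3 : Bd (‖(p : K)‖ * (ε * ϖ)) ((p : PowerSeries K) * (h * ((c : PowerSeries K) ^ (p - 1) - 1))) :=
    (Bd.natCast p).mul hna (hc.mul hna b2)
  have b4 : Bd (‖(p : K)‖ * (ϖ * ε)) ((p : PowerSeries K) * h - ((G : PowerSeries K) - (c : PowerSeries K) ^ p)) := by
    have e : (p : PowerSeries K) * h - ((G : PowerSeries K) - (c : PowerSeries K) ^ p) =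
      (θ ^ p - (G : PowerSeries K)) - ((((c : PowerSeries K) + h) ^ p - (c : PowerSeries K) ^ p - (p : PowerSeries K) * (h * (c : PowerSeries K) ^ (p - 1)) - h ^ p)
        + (p : PowerSeries K) * (h * ((c : PowerSeries K) ^ (p - 1) - 1)) + h ^ p) := by
      have : (c : PowerSeries K) + h = θ := by rw [hh]; ring
      rw [this]; ring
    rw [e]
    refine hG.sub hna (((b1.mono ?_).add hna (b3.mono (by rw [mul_comm ε]))).add hna ((hc.pow hna p).mono hεp))
    gcongr
    rw [pow_two]; gcongr
  refine ⟨c + Polynomial.C (p : K)⁻¹ * (G - c ^ p), ?_⟩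
  have e : θ - ((c + Polynomial.C (p : K)⁻¹ * (G - c ^ p) : Polynomial K) : PowerSeries K) =
      PowerSeries.C (p : K)⁻¹ * ((p : PowerSeries K) * h - ((G : PowerSeries K) - (c : PowerSeries K) ^ p)) := by
    have : PowerSeries.C (p : K)⁻¹ * (p : PowerSeries K) = 1 := by
      rw [← map_natCast (PowerSeries.C (R := K)), ← map_mul, inv_mul_cancel₀ hp0, map_one]
    have h2 : θ = (c : PowerSeries K) + h := by rw [hh]; ring
    push_cast
    linear_combination h2 - h * this
  rw [e]
  have := (Bd.C (p : K)⁻¹).mul hna b4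
  rwa [norm_inv, ← mul_assoc, inv_mul_cancel₀ (norm_ne_zero_iff.2 hp0), one_mul] at this

end Series
section Splitting
open PowerSeries Filter Topology

variable {K : Type} [NormedField K]

theorem Ap.of_eventually {r : ℝ} (hr : 0 ≤ r) {f : PowerSeries K}
    (h : ∃ N, ∀ n ≥ N, ‖coeff n f‖ ≤ r) : Ap r f := by
  obtain ⟨N, hN⟩ := h
  refine ⟨trunc N f, fun n => ?_⟩
  rw [map_sub, Polynomial.coeff_coe, coeff_trunc]
  split_ifs with h1
  · simpa using hr
  · rw [sub_zero]; exact hN n (by omega)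

theorem Ap.eventually {r : ℝ} {f : PowerSeries K} (h : Ap r f) :
    ∃ N, ∀ n ≥ N, ‖coeff n f‖ ≤ r := by
  obtain ⟨c, hc⟩ := h
  refine ⟨c.natDegree + 1, fun n hn => ?_⟩
  have := hc n
  rwa [map_sub, Polynomial.coeff_coe, Polynomial.coeff_eq_zero_of_natDegree_lt (by omega), sub_zero]
    at this

theorem Ap.mul (hna : IsUltrametricDist K) {r : ℝ} (hr : r ≤ 1) {f g : PowerSeries K}
    (hf1 : Bd 1 f) (hg1 : Bd 1 g) (hf : Ap r f) (hg : Ap r g) : Ap r (f * g) := by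
  obtain ⟨c, hc⟩ := hf
  obtain ⟨d, hd⟩ := hg
  have hc1 : Bd 1 (c : PowerSeries K) := by
    have : (c : PowerSeries K) = f - (f - (c : PowerSeries K)) := by ring
    rw [this]; exact hf1.sub hna (hc.mono hr)
  refine ⟨c * d, ?_⟩
  have e : f * g - ((c * d : Polynomial K) : PowerSeries K) =
      (f - (c : PowerSeries K)) * g + (c : PowerSeries K) * (g - (d : PowerSeries K)) := by
    push_cast; ring
  rw [e]
  have h1 := hc.mul hna hg1
  have h2 := hc1.mul hna hd
  rw [mul_one] at h1
  rw [one_mul] at h2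
  exact h1.add hna h2

theorem Bd.expand {r : ℝ} {f : PowerSeries K} (hf : Bd r f) (q : ℕ) (hq : q ≠ 0) :
    Bd r (f.expand q hq) := by
  intro n
  rw [coeff_expand]
  split_ifs
  · exact hf _
  · simpa using hf.nonneg

theorem Ap.expand {r : ℝ} {f : PowerSeries K} (hf : Ap r f) (q : ℕ) (hq : q ≠ 0) :
    Ap r (f.expand q hq) := by
  have hr : 0 ≤ r := by obtain ⟨c, hc⟩ := hf; exact hc.nonneg
  obtain ⟨N, hN⟩ := hf.eventually
  refine Ap.of_eventually hr ⟨q * N, fun n hn => ?_⟩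
  rw [coeff_expand]
  split_ifs
  · refine hN _ ?_
    rw [ge_iff_le, Nat.le_div_iff_mul_le (Nat.pos_of_ne_zero hq), mul_comm]; exact hn
  · simpa using hr

variable [CharZero K]

/-- `exp(aX)` -/
noncomputable def exS (a : K) : PowerSeries K := rescale a (exp K)

theorem coeff_exS (a : K) (n : ℕ) : coeff n (exS a) = a ^ n / (n.factorial : K) := by
  unfold exS
  rw [coeff_rescale, coeff_exp]
  simp [div_eq_mul_inv]

theorem exS_pow (a : K) (k : ℕ) : exS a ^ k = exS (k * a) := by
  unfold exS
  rw [← map_pow, exp_pow_eq_rescale_exp, rescale_rescale]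

/-- the splitting function -/
noncomputable def thS (q : ℕ) (hq : q ≠ 0) (π : K) : PowerSeries K :=
  exS π * (exS (-π)).expand q hq

theorem coeff_thS (p m : ℕ) (hq : p ^ m ≠ 0) (π : K) (u : ℕ) :
    coeff u (thS (p ^ m) hq π) = lam p m π u := by
  unfold thS lam
  rw [coeff_mul]
  have hq0 := Nat.pos_of_ne_zero hq
  symm
  refine Finset.sum_of_injOn (fun s => (u - p ^ m * s, p ^ m * s)) ?_ ?_ ?_ ?_
  · intro a _ b _ hab
    simp only [Prod.mk.injEq] at hab
    exact Nat.eq_of_mul_eq_mul_left hq0 hab.2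
  · intro s hs
    simp only [Finset.coe_range, Set.mem_Iio] at hs
    have : p ^ m * s ≤ u := by
      calc p ^ m * s ≤ p ^ m * (u / p ^ m) := Nat.mul_le_mul_left _ (by omega)
        _ ≤ u := Nat.mul_div_le _ _
    simp; omega
  · intro x hx hx'
    rw [Finset.HasAntidiagonal.mem_antidiagonal] at hx
    rw [coeff_expand, if_neg, mul_zero]
    rintro ⟨s, hs⟩
    apply hx'
    refine ⟨s, ?_, ?_⟩
    · simp only [Finset.coe_range, Set.mem_Iio]
      rw [Nat.lt_succ_iff, Nat.le_div_iff_mul_le hq0, mul_comm]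
      omega
    · ext <;> simp <;> omega
  · intro s _
    simp only [coeff_expand_mul, coeff_exS]
    rw [neg_pow, pow_add]
    ring

theorem thS_pow (q : ℕ) (hq : q ≠ 0) (π : K) (k : ℕ) :
    thS q hq π ^ k = exS (k * π) * (exS (-(k * π))).expand q hq := by
  unfold thS
  rw [mul_pow, ← map_pow, exS_pow, exS_pow, mul_neg]

theorem norm_coeff_exS (hna : IsUltrametricDist K) (p : ℕ) (hp : p.Prime)
    (hpnorm : ‖(p : K)‖ = (p : ℝ)⁻¹) (π : K) (hπ : π ^ (p - 1) = -(p : K))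
    (a : K) (ha : ‖a‖ = ‖(p : K) * π‖) (n : ℕ) :
    ‖coeff n (exS a)‖ = ‖(p : K)‖ ^ n * ‖π‖ ^ sp p n := by
  rw [coeff_exS, ← norm_pi_div_fact hna p hp hpnorm π hπ, norm_div, norm_pow, ha, norm_mul, norm_div,
    norm_pow, mul_pow, mul_div_assoc]

theorem exS_main (hna : IsUltrametricDist K) (p : ℕ) (hp : p.Prime)
    (hpnorm : ‖(p : K)‖ = (p : ℝ)⁻¹) (π : K) (hπ : π ^ (p - 1) = -(p : K))
    (a : K) (ha : ‖a‖ = ‖(p : K) * π‖) :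
    Bd 1 (exS a) ∧ Bd (‖(p : K)‖ * ‖π‖ ^ 2) (exS a - 1 - C a * X) ∧ ∀ r > 0, Ap r (exS a) := by
  have hw0 := pi_pos p hp π hπ
  have hw1 := pi_lt_one p hp hpnorm π hπ
  have hpp := norm_prime_eq p π hπ
  have hp2 := hp.two_le
  have hpw : ‖(p : K)‖ ≤ ‖π‖ := by
    rw [hpp]; exact pow_le_of_le_one hw0.le hw1.le (by omega)
  have hp0 : 0 ≤ ‖(p : K)‖ := norm_nonneg _
  have hp1 : ‖(p : K)‖ < 1 := hpw.trans_lt hw1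
  have hn := norm_coeff_exS hna p hp hpnorm π hπ a ha
  refine ⟨?_, ?_, ?_⟩
  · intro n
    rw [hn]
    exact mul_le_one₀ (pow_le_one₀ hp0 hp1.le) (by positivity) (pow_le_one₀ hw0.le hw1.le)
  · intro n
    rw [map_sub, map_sub, coeff_C_mul, coeff_X, coeff_one]
    rcases Nat.lt_or_ge n 2 with h | h
    · interval_cases n
      · simp [coeff_exS]; positivity
      · simp [coeff_exS]; positivity
    · rw [if_neg (by omega), if_neg (by omega), sub_zero, mul_zero, sub_zero, hn]
      have h1 : ‖(p : K)‖ ^ n ≤ ‖(p : K)‖ ^ 2 := pow_le_pow_of_le_one hp0 hp1.le h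
      have h2 : ‖π‖ ^ sp p n ≤ ‖π‖ :=
        pow_le_of_le_one hw0.le hw1.le (by have := sp_pos p hp n (by omega); omega)
      calc _ ≤ ‖(p : K)‖ ^ 2 * ‖π‖ := by gcongr
        _ = ‖(p : K)‖ * ‖(p : K)‖ * ‖π‖ := by ring
        _ ≤ ‖(p : K)‖ * ‖π‖ * ‖π‖ := by gcongr
        _ = _ := by ring
  · intro r hr
    obtain ⟨N, hN⟩ := exists_pow_lt_of_lt_one hr hp1
    refine Ap.of_eventually hr.le ⟨N, fun n hn' => ?_⟩
    rw [hn]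
    calc _ ≤ ‖(p : K)‖ ^ n * 1 := by
          gcongr; exact pow_le_one₀ hw0.le hw1.le
      _ ≤ ‖(p : K)‖ ^ N := by rw [mul_one]; exact pow_le_pow_of_le_one hp0 hp1.le hn'
      _ ≤ r := hN.le

theorem hsum_pow (hna : IsUltrametricDist K) (p : ℕ) (hp : p.Prime) (m : ℕ) :
    Bd ‖(p : K)‖ ((∑ i ∈ Finset.range m, X ^ (p ^ i) : PowerSeries K) ^ p
      - ∑ i ∈ Finset.range m, X ^ (p ^ (i + 1))) := by
  induction m with
  | zero => simpa [hp.ne_zero] using Bd.zero (K := K) (r := (‖(p : K)‖)) (norm_nonneg _)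
  | succ m ih =>
    rw [Finset.sum_range_succ, Finset.sum_range_succ]
    set c : PowerSeries K := ∑ i ∈ Finset.range m, X ^ (p ^ i) with hc
    set c' : PowerSeries K := ∑ i ∈ Finset.range m, X ^ (p ^ (i + 1)) with hc'
    have hc1 : Bd 1 c := Bd.sum hna zero_le_one _ _ fun i _ => Bd.Xpow _
    have h1 := Bd.binom hna p hp le_rfl hc1 (Bd.Xpow (K := K) (p ^ m))
    have h2 := (Bd.natCast (K := K) p).mul hna
      ((Bd.Xpow (K := K) (p ^ m)).mul hna (hc1.pow_one hna (p - 1)))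
    have e : (c + X ^ p ^ m) ^ p - (c' + X ^ p ^ (m + 1)) =
      (c ^ p - c') + ((c + X ^ p ^ m) ^ p - c ^ p - (p : PowerSeries K) * (X ^ p ^ m * c ^ (p - 1)) -
        (X ^ p ^ m) ^ p) + (p : PowerSeries K) * (X ^ p ^ m * c ^ (p - 1)) := by
      rw [← pow_mul, ← pow_succ]; ring
    rw [e]
    exact (ih.add hna (h1.mono (by simp))).add hna (h2.mono (by simp))

theorem thS_Ap (hna : IsUltrametricDist K) (p m : ℕ) (hp : p.Prime)
    (hpnorm : ‖(p : K)‖ = (p : ℝ)⁻¹) (π : K) (hπ : π ^ (p - 1) = -(p : K)) (hq : p ^ m ≠ 0) (k : ℕ) :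
    Ap (‖π‖ ^ (k + 2)) (thS (p ^ m) hq π) := by
  have hw0 := pi_pos p hp π hπ
  have hw1 := pi_lt_one p hp hpnorm π hπ
  have hpp := norm_prime_eq p π hπ
  have hp2 := hp.two_le
  have hpw : ‖(p : K)‖ ≤ ‖π‖ := by
    rw [hpp]; exact pow_le_of_le_one hw0.le hw1.le (by omega)
  have hp0 : 0 ≤ ‖(p : K)‖ := norm_nonneg _
  have hp1 : ‖(p : K)‖ < 1 := hpw.trans_lt hw1
  have hpne : (p : K) ≠ 0 := by exact_mod_cast hp.ne_zero
  set θ := thS (p ^ m) hq π with hθ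
  have hθ1 : Bd ‖π‖ (θ - 1) := by
    intro n
    rw [map_sub, coeff_thS, coeff_one]
    split_ifs with h
    · subst h; simp [lam]
    · rw [sub_zero]
      refine (norm_lam_le hna p m hp hpnorm π hπ n).trans ?_
      exact pow_le_of_le_one hw0.le hw1.le (by have := sp_pos p hp n (by omega); omega)
  have hθ0 : coeff 0 θ = 1 := by rw [coeff_thS]; simp [lam]
  obtain ⟨A1, A2, A3⟩ := exS_main hna p hp hpnorm π hπ (p * π) rfl
  obtain ⟨B1, B2, B3⟩ := exS_main hna p hp hpnorm π hπ (-(p * π)) (norm_neg _)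
  have hG : θ ^ p = exS (p * π) * (exS (-(p * π))).expand (p ^ m) hq := thS_pow _ _ _ _
  set H1 : PowerSeries K := exS (p * π)
  set H2 : PowerSeries K := (exS (-(p * π))).expand (p ^ m) hq with hH2
  have hH21 : Bd 1 H2 := B1.expand _ hq
  have hGAp : ∀ r > 0, r ≤ 1 → Ap r (θ ^ p) := by
    intro r hr hr1
    rw [hG]
    exact Ap.mul hna hr1 A1 hH21 (A3 r hr) ((B3 r hr).expand _ hq)
  set a : PowerSeries K := C ((p : K) * π) with ha
  have haB : Bd (‖(p : K)‖ * ‖π‖) a := by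
    have := Bd.C ((p : K) * π)
    rwa [norm_mul] at this
  have hX1 : Bd 1 (X : PowerSeries K) := by simpa using Bd.Xpow (K := K) 1
  have hδ : ‖(p : K)‖ * ‖π‖ * ‖(p : K)‖ ≤ ‖(p : K)‖ * ‖π‖ ^ 2 := by
    rw [pow_two, ← mul_assoc]; gcongr
  have B2' : Bd (‖(p : K)‖ * ‖π‖ ^ 2) (H2 - 1 + a * X ^ (p ^ m)) := by
    have := B2.expand (p ^ m) hq
    rw [map_sub, map_sub, map_one, map_mul, expand_C, expand_X, map_neg, neg_mul, sub_neg_eq_add] at this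
    exact this
  have hG1 : Bd (‖(p : K)‖ * ‖π‖ ^ 2) (θ ^ p - 1 - a * (X - X ^ (p ^ m))) := by
    have e : θ ^ p - 1 - a * (X - X ^ (p ^ m)) = (H1 - 1 - a * X) * H2
        + (1 + a * X) * (H2 - 1 + a * X ^ (p ^ m)) - a * a * (X * X ^ (p ^ m)) := by
      rw [hG]; ring
    rw [e]
    have t1 := A2.mul hna hH21
    have t2 : Bd 1 (1 + a * X) := by
      refine Bd.one.add hna (((haB.mul hna hX1)).mono ?_)
      rw [mul_one]
      exact mul_le_one₀ hp1.le hw0.le hw1.le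
    have t3 := t2.mul hna B2'
    have t4 := (haB.mul hna haB).mul hna (hX1.mul hna (Bd.Xpow (K := K) (p ^ m)))
    refine ((t1.mono (by simp)).add hna (t3.mono (by simp))).sub hna (t4.mono ?_)
    rw [mul_one, mul_one]
    refine le_trans ?_ hδ
    rw [← mul_assoc]
    exact mul_le_of_le_one_right (by positivity) hw1.le
  have hbase : Ap (‖π‖ ^ 2) θ := by
    set h0 : PowerSeries K := ∑ i ∈ Finset.range m, X ^ (p ^ i) with hh0
    have hh01 : Bd 1 h0 := Bd.sum hna zero_le_one _ _ fun i _ => Bd.Xpow _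
    have hh0p := hsum_pow (K := K) hna p hp m
    rw [← hh0] at hh0p
    have htel : ∑ i ∈ Finset.range m, (X : PowerSeries K) ^ (p ^ (i + 1)) = h0 - (X - X ^ (p ^ m)) := by
      have := Finset.sum_range_sub (fun i => (X : PowerSeries K) ^ (p ^ i)) m
      rw [Finset.sum_sub_distrib, ← hh0] at this
      simp only [pow_zero, pow_one] at this
      linear_combination this
    rw [htel] at hh0p
    have hCh : Bd ‖π‖ (C π * h0) := by simpa using (Bd.C π).mul hna hh01
    have hc1 : Bd 1 (1 + C π * h0) := Bd.one.add hna (hCh.mono hw1.le)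
    set c : PowerSeries K := 1 + C π * h0 with hc
    set e := θ - c with he
    have heB : Bd ‖π‖ e := by
      have : e = (θ - 1) - C π * h0 := by rw [he, hc]; ring
      rw [this]; exact hθ1.sub hna hCh
    have ρ1 := Bd.binom hna p hp hw1.le hc1 heB
    have ρ2 := Bd.binom hna p hp hw1.le Bd.one hCh
    have hcm : Bd ‖π‖ (c - 1) := by rw [hc]; simpa using hCh
    have ρ3 := (Bd.natCast (K := K) p).mul hna (heB.mul hna (hcm.pow_sub_one hna hw1.le (p - 1)))
    have ρ4 := haB.mul hna hh0p
    have hπp : (C π : PowerSeries K) ^ p = - a := by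
      have : π ^ p = - (p * π) := by
        have : p = (p - 1) + 1 := by omega
        conv_lhs => rw [this, pow_succ, hπ]
        ring
      rw [← map_pow, this, map_neg]
    have ha' : a = (p : PowerSeries K) * C π := by rw [ha, map_mul, map_natCast]
    have hce : c + e = θ := by rw [he]; ring
    have key : Bd (‖(p : K)‖ * ‖π‖ ^ 2) ((p : PowerSeries K) * e + e ^ p) := by
      have eq : (p : PowerSeries K) * e + e ^ p =
          (θ ^ p - 1 - a * (X - X ^ (p ^ m)))
          - ((c + e) ^ p - c ^ p - (p : PowerSeries K) * (e * c ^ (p - 1)) - e ^ p)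
          - ((1 + C π * h0) ^ p - 1 ^ p - (p : PowerSeries K) * (C π * h0 * 1 ^ (p - 1)) - (C π * h0) ^ p)
          - (p : PowerSeries K) * (e * (c ^ (p - 1) - 1))
          + a * (h0 ^ p - (h0 - (X - X ^ (p ^ m)))) := by
        rw [hce, ← hc, mul_pow, hπp, one_pow, one_pow, ha']
        ring
      rw [eq]
      refine ((((hG1.sub hna ρ1).sub hna ρ2).sub hna (ρ3.mono ?_))).add hna (ρ4.mono hδ)
      rw [pow_two]
    have he0 : coeff 0 e = 0 := by
      have : coeff 0 h0 = 0 := by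
        rw [hh0, map_sum]
        refine Finset.sum_eq_zero fun i _ => ?_
        rw [coeff_X_pow, if_neg]
        exact (pow_pos hp.pos i).ne
      rw [he, hc, map_sub, map_add, hθ0, coeff_C_mul, this]
      simp
    have hfin := base_step hna p hp hpne (by positivity) (by
      rw [hpp, ← pow_add, ← pow_mul]
      exact pow_le_pow_of_le_one hw0.le hw1.le (by omega)) e he0 key
    refine ⟨1 + Polynomial.C π * ∑ i ∈ Finset.range m, Polynomial.X ^ (p ^ i), ?_⟩
    have : ((1 + Polynomial.C π * ∑ i ∈ Finset.range m, Polynomial.X ^ (p ^ i) : Polynomial K) :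
        PowerSeries K) = c := by
      have h2 : ((∑ i ∈ Finset.range m, Polynomial.X ^ (p ^ i) : Polynomial K) : PowerSeries K) = h0 := by
        rw [← Polynomial.coeToPowerSeries.ringHom_apply, map_sum]
        simp [hh0]
      rw [Polynomial.coe_add, Polynomial.coe_mul, h2]
      simp [hc]
    rw [this]
    exact hfin
  induction k with
  | zero => simpa using hbase
  | succ k ih =>
    have : ‖π‖ ^ (k + 1 + 2) = ‖π‖ * ‖π‖ ^ (k + 2) := by ring
    rw [this]
    refine ind_step hna p hp hpne hw0.le hw1.le (pow_le_of_le_one hw0.le hw1.le (by omega)) ?_ θ hθ1 ?_ ih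
    · rw [hpp, ← pow_succ', ← pow_add, ← pow_mul]
      refine pow_le_pow_of_le_one hw0.le hw1.le ?_
      obtain ⟨b, rfl⟩ : ∃ b, p = b + 2 := ⟨p - 2, by omega⟩
      have : b + 2 - 1 = b + 1 := by omega
      rw [this]; nlinarith
    · have hpos : 0 < ‖(p : K)‖ := norm_pos_iff.2 hpne
      refine hGAp _ (by positivity) ?_
      exact mul_le_one₀ hp1.le (by positivity) (mul_le_one₀ hw1.le (by positivity) (pow_le_one₀ hw0.le hw1.le))

theorem lam_small (hna : IsUltrametricDist K) (p m : ℕ) (hp : p.Prime)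
    (hpnorm : ‖(p : K)‖ = (p : ℝ)⁻¹) (π : K) (hπ : π ^ (p - 1) = -(p : K)) (ε : ℝ) (hε : 0 < ε) :
    ∃ N, ∀ n ≥ N, ‖lam p m π n‖ ≤ ε := by
  have hw0 := pi_pos p hp π hπ
  have hw1 := pi_lt_one p hp hpnorm π hπ
  have hq : p ^ m ≠ 0 := (pow_pos hp.pos m).ne'
  obtain ⟨k, hk⟩ := exists_pow_lt_of_lt_one hε hw1
  obtain ⟨N, hN⟩ := (thS_Ap hna p m hp hpnorm π hπ hq k).eventually
  refine ⟨N, fun n hn => ?_⟩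
  have := hN n hn
  rw [coeff_thS] at this
  exact this.trans ((pow_le_pow_of_le_one hw0.le hw1.le (by omega)).trans hk.le)

end Splitting

section Final
open Filter Topology

variable {K : Type} [NormedField K] [CharZero K]

theorem norm_lam_le_one (hna : IsUltrametricDist K) (p m : ℕ) (hp : p.Prime)
    (hpnorm : ‖(p : K)‖ = (p : ℝ)⁻¹) (π : K) (hπ : π ^ (p - 1) = -(p : K)) (u : ℕ) :
    ‖lam p m π u‖ ≤ 1 :=
  (norm_lam_le hna p m hp hpnorm π hπ u).trans
    (pow_le_one₀ (norm_nonneg _) (pi_lt_one p hp hpnorm π hπ).le)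

theorem fcoefZ_cases (hna : IsUltrametricDist K) (p m : ℕ) (π : K)
    (D : Finset (ι → ℕ)) (γ : D → K) (hγ : ∀ d, ‖γ d‖ ≤ 1) (x y : ι → ℕ) :
    fcoefZ p m π D γ (fun k => (p : ℤ) ^ m * (x k : ℤ) - (y k : ℤ)) = 0 ∨
    ∃ u : D → ℕ, (∀ k, sigmaSum D u k + y k = p ^ m * x k) ∧
      ‖fcoefZ p m π D γ (fun k => (p : ℤ) ^ m * (x k : ℤ) - (y k : ℤ))‖ ≤
        ∏ d, ‖lam p m π (u d)‖ := by
  unfold fcoefZ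
  split_ifs with h
  · unfold fcoef
    set S := (Fintype.piFinset fun _ : D => Finset.range
      ((∑ k, ((p : ℤ) ^ m * (x k : ℤ) - (y k : ℤ)).toNat) + 1)) |>.filter
      (fun u : D → ℕ => ∀ k, sigmaSum D u k = ((p : ℤ) ^ m * (x k : ℤ) - (y k : ℤ)).toNat) with hS
    rcases S.eq_empty_or_nonempty with he | hne
    · left
      rw [he, Finset.sum_empty]
    · right
      obtain ⟨u, hu, hle⟩ := IsUltrametricDist.exists_norm_finsetSum_le_of_nonempty hne
        (fun u : D → ℕ => ∏ d, lam p m π (u d) * γ d ^ u d)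
      refine ⟨u, fun k => ?_, hle.trans ?_⟩
      · have h1 := (Finset.mem_filter.1 hu).2 k
        have h2 : 0 ≤ (p : ℤ) ^ m * (x k : ℤ) - (y k : ℤ) := h k
        have h3 : ((p ^ m * x k : ℕ) : ℤ) = (p : ℤ) ^ m * (x k : ℤ) := by push_cast; ring
        rw [← h3] at h1 h2
        omega
      · rw [norm_prod]
        refine Finset.prod_le_prod (fun _ _ => norm_nonneg _) fun d _ => ?_
        rw [norm_mul, norm_pow]
        exact mul_le_of_le_one_right (norm_nonneg _) (pow_le_one₀ (norm_nonneg _) (hγ d))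
  · left; rfl

theorem det_bound (hna : IsUltrametricDist K) (p m : ℕ) (π : K)
    (D : Finset (ι → ℕ)) (γ : D → K) (hγ : ∀ d, ‖γ d‖ ≤ 1) (F : Finset (ι → ℕ)) (C : ℝ) (hC : 0 ≤ C)
    (H : ∀ (σ : Equiv.Perm F) (u : F → D → ℕ),
      (∀ i k, sigmaSum D (u i) k + (i : ι → ℕ) k = p ^ m * ((σ i : F) : ι → ℕ) k) →
      ∏ i, ∏ d, ‖lam p m π (u i d)‖ ≤ C) :
    ‖Matrix.det (Matrix.of fun i j : ↥F =>
        fcoefZ p m π D γ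
          (fun k => (p : ℤ) ^ m * ((i : ι → ℕ) k : ℤ) - ((j : ι → ℕ) k : ℤ)))‖ ≤ C := by
  rw [Matrix.det_apply]
  refine IsUltrametricDist.norm_sum_le_of_forall_le_of_nonneg hC fun σ _ => ?_
  have hsign : ∀ z : K, ‖Equiv.Perm.sign σ • z‖ = ‖z‖ := by
    intro z
    rcases Int.units_eq_one_or (Equiv.Perm.sign σ) with h | h <;> rw [h] <;> simp
  rw [hsign]
  simp only [Matrix.of_apply]
  by_cases hz : ∃ i : F, fcoefZ p m π D γ
      (fun k => (p : ℤ) ^ m * (((σ i : F) : ι → ℕ) k : ℤ) - ((i : ι → ℕ) k : ℤ)) = 0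
  · obtain ⟨i, hi⟩ := hz
    rw [Finset.prod_eq_zero (Finset.mem_univ i) hi, norm_zero]
    exact hC
  · push Not at hz
    have := fun i : F => (fcoefZ_cases hna p m π D γ hγ (σ i : F) i).resolve_left (hz i)
    choose u hu hle using this
    rw [norm_prod]
    exact (Finset.prod_le_prod (fun _ _ => norm_nonneg _) fun i _ => hle i).trans (H σ u hu)

theorem det_uniform (hna : IsUltrametricDist K) (p m : ℕ) (hp : p.Prime) (hm : 1 ≤ m)
    (hpnorm : ‖(p : K)‖ = (p : ℝ)⁻¹) (π : K) (hπ : π ^ (p - 1) = -(p : K))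
    (D : Finset (ι → ℕ)) (F : Finset (ι → ℕ)) (hF : ∀ i ∈ F, ∀ k, 0 < i k)
    (σ : Equiv.Perm F) (u : F → D → ℕ)
    (hu : ∀ i k, sigmaSum D (u i) k + (i : ι → ℕ) k = p ^ m * ((σ i : F) : ι → ℕ) k) :
    ∏ i, ∏ d, ‖lam p m π (u i d)‖ ≤ (p : ℝ) ^ (-((m : ℝ) * (F.card : ℝ) * density p D)) := by
  have h1 : ∏ i, ∏ d, ‖lam p m π (u i d)‖ ≤ ‖π‖ ^ (∑ i, spU p D (u i)) := by
    rw [← Finset.prod_pow_eq_pow_sum]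
    refine Finset.prod_le_prod (fun _ _ => Finset.prod_nonneg fun _ _ => norm_nonneg _) fun i _ => ?_
    unfold spU
    rw [← Finset.prod_pow_eq_pow_sum]
    exact Finset.prod_le_prod (fun _ _ => norm_nonneg _) fun d _ =>
      norm_lam_le hna p m hp hpnorm π hπ _
  refine h1.trans ?_
  have hb := perm_bound p m hp hm D (fun i : F => (i : ι → ℕ)) (fun i k => hF i i.2 k) σ u hu
  rw [Fintype.card_coe] at hb
  have hp1 : (1 : ℝ) < p := by exact_mod_cast hp.one_lt
  have hpp : (0 : ℝ) < p - 1 := by linarith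
  have hπ0 := pi_pos p hp π hπ
  have hn : ‖π‖ = (p : ℝ) ^ (-(1 / ((p : ℝ) - 1))) := by
    have e1 : ‖π‖ ^ (p - 1) = (p : ℝ)⁻¹ := by rw [← norm_prime_eq p π hπ, hpnorm]
    have e2 : ‖π‖ ^ ((p : ℝ) - 1) = (p : ℝ)⁻¹ := by
      rw [← e1, ← Real.rpow_natCast, Nat.cast_sub hp.one_le, Nat.cast_one]
    have e3 : (‖π‖ ^ ((p : ℝ) - 1)) ^ (1 / ((p : ℝ) - 1)) = ‖π‖ := by
      rw [← Real.rpow_mul hπ0.le, mul_one_div_cancel hpp.ne', Real.rpow_one]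
    rw [← e3, e2, Real.inv_rpow (by linarith), ← Real.rpow_neg (by linarith)]
  rw [hn, ← Real.rpow_natCast, ← Real.rpow_mul (by linarith)]
  refine Real.rpow_le_rpow_of_exponent_le hp1.le ?_
  rw [neg_mul, neg_le_neg_iff, one_div, inv_mul_eq_div, le_div_iff₀ hpp]
  linarith

theorem det_small (hna : IsUltrametricDist K) (p m : ℕ) (hp : p.Prime) (hm : 1 ≤ m)
    (hpnorm : ‖(p : K)‖ = (p : ℝ)⁻¹) (π : K) (hπ : π ^ (p - 1) = -(p : K))
    (D : Finset (ι → ℕ)) (ε : ℝ) (N : ℕ) (hN : ∀ n ≥ N, ‖lam p m π n‖ ≤ ε)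
    (F : Finset (ι → ℕ))
    (hF : F.card * (N * ∑ d : D, ∑ k, (d : ι → ℕ) k) < ∑ i : F, ∑ k, (i : ι → ℕ) k)
    (σ : Equiv.Perm F) (u : F → D → ℕ)
    (hu : ∀ i k, sigmaSum D (u i) k + (i : ι → ℕ) k = p ^ m * ((σ i : F) : ι → ℕ) k) :
    ∏ i, ∏ d, ‖lam p m π (u i d)‖ ≤ ε := by
  have key : ∃ i d, N ≤ u i d := by
    by_contra hcon
    push Not at hcon
    have h2 : 2 ≤ p ^ m := hp.two_le.trans (Nat.le_self_pow (by omega) p)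
    have e1 : (∑ i, ∑ k, sigmaSum D (u i) k) + ∑ i : F, ∑ k, (i : ι → ℕ) k =
        p ^ m * ∑ i : F, ∑ k, (i : ι → ℕ) k := by
      rw [← Equiv.sum_comp σ (fun i : F => ∑ k, (i : ι → ℕ) k), Finset.mul_sum,
        Equiv.sum_comp σ (fun i : F => ∑ k, (i : ι → ℕ) k), ← Finset.sum_add_distrib]
      refine Finset.sum_congr rfl fun i _ => ?_
      rw [Finset.mul_sum, ← Finset.sum_add_distrib]
      exact Finset.sum_congr rfl fun k _ => hu i k
    have e2 : ∑ i, ∑ k, sigmaSum D (u i) k ≤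
        F.card * (N * ∑ d : D, ∑ k, (d : ι → ℕ) k) := by
      have : ∀ i ∈ (Finset.univ : Finset F), ∑ k, sigmaSum D (u i) k ≤
          N * ∑ d : D, ∑ k, (d : ι → ℕ) k := by
        intro i _
        unfold sigmaSum
        rw [Finset.sum_comm, Finset.mul_sum]
        refine Finset.sum_le_sum fun d _ => ?_
        rw [Finset.mul_sum]
        exact Finset.sum_le_sum fun k _ => Nat.mul_le_mul_right _ (hcon i d).le
      have := Finset.sum_le_card_nsmul _ _ _ this
      simpa using this
    have e3 := Nat.mul_le_mul_right (∑ i : F, ∑ k, (i : ι → ℕ) k) h2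
    omega
  obtain ⟨i, d, hid⟩ := key
  have hle1 := norm_lam_le_one hna p m hp hpnorm π hπ
  rw [← Finset.mul_prod_erase _ _ (Finset.mem_univ i),
    ← Finset.mul_prod_erase _ _ (Finset.mem_univ d)]
  refine (mul_le_of_le_one_right ?_ ?_).trans ((mul_le_of_le_one_right (norm_nonneg _) ?_).trans
    (hN _ hid))
  · exact mul_nonneg (norm_nonneg _) (Finset.prod_nonneg fun _ _ => norm_nonneg _)
  · exact Finset.prod_le_one (fun _ _ => Finset.prod_nonneg fun _ _ => norm_nonneg _)
      fun _ _ => Finset.prod_le_one (fun _ _ => norm_nonneg _) fun _ _ => hle1 _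
  · exact Finset.prod_le_one (fun _ _ => norm_nonneg _) fun _ _ => hle1 _

end Final

/-- For every `s ≥ 1`, the family `(det A[F])`, indexed by the finite subsets
`F ⊂ (ℕ_{>0})^n` of cardinality `s`, is summable, and its sum — the degree-`s`
coefficient `ℓ^{(m)}_s` of the Fredholm determinant `det(I − T·A(Γ))` —
satisfies `‖ℓ^{(m)}_s‖ ≤ p^{−m·s·δ_p(D)}`. -/
theorem fredholm_coeff_bound (p m : ℕ) (hp : p.Prime) (hm : 1 ≤ m)
    {K : Type} [NormedField K] [CharZero K] [CompleteSpace K]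
    (hna : IsUltrametricDist K) (hpnorm : ‖(p : K)‖ = (p : ℝ)⁻¹)
    (π : K) (hπ : π ^ (p - 1) = -(p : K))
    {ι : Type} [Fintype ι] [Nonempty ι]
    (D : Finset (ι → ℕ)) (hD : D.Nonempty) (h0D : (fun _ => 0) ∉ D)
    (hcoord : ∀ k : ι, ∃ d ∈ D, 0 < d k)
    (γ : D → K) (hγ : ∀ d, ‖γ d‖ ≤ 1)
    (s : ℕ) (hs : 1 ≤ s)
    (detA : Finset (ι → ℕ) → K)
    (hdetA : detA = fun F : Finset (ι → ℕ) => Matrix.det (Matrix.of fun i j : ↥F =>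
        fcoefZ p m π D γ
          (fun k => (p : ℤ) ^ m * ((i : ι → ℕ) k : ℤ) - ((j : ι → ℕ) k : ℤ)))) :
    Summable (fun F : {F : Finset (ι → ℕ) // (∀ i ∈ F, ∀ k, 0 < i k) ∧ F.card = s} =>
        detA F.1) ∧
    ‖∑' F : {F : Finset (ι → ℕ) // (∀ i ∈ F, ∀ k, 0 < i k) ∧ F.card = s}, detA F.1‖ ≤
      (p : ℝ) ^ (-((m : ℝ) * (s : ℝ) * density p D)) := by
  have hbound : ∀ F : {F : Finset (ι → ℕ) // (∀ i ∈ F, ∀ k, 0 < i k) ∧ F.card = s},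
      ‖detA F.1‖ ≤ (p : ℝ) ^ (-((m : ℝ) * (s : ℝ) * density p D)) := by
    rintro ⟨F, hF, rfl⟩
    subst hdetA
    exact det_bound hna p m π D γ hγ F _ (Real.rpow_nonneg (Nat.cast_nonneg p) _)
      (det_uniform hna p m hp hm hpnorm π hπ D F hF)
  refine ⟨?_, IsUltrametricDist.norm_tsum_le_of_forall_le_of_nonneg
    (Real.rpow_nonneg (Nat.cast_nonneg p) _) hbound⟩
  apply NonarchimedeanAddGroup.summable_of_tendsto_cofinite_zero
  rw [tendsto_zero_iff_norm_tendsto_zero, Metric.tendsto_nhds]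
  intro ε hε
  obtain ⟨N, hN⟩ := lam_small hna p m hp hpnorm π hπ (ε / 2) (half_pos hε)
  rw [Filter.eventually_cofinite]
  set B := s * (N * ∑ d : D, ∑ k, (d : ι → ℕ) k) with hB
  have hfin : Set.Finite {F : {F : Finset (ι → ℕ) // (∀ i ∈ F, ∀ k, 0 < i k) ∧ F.card = s} |
      F.1 ⊆ Fintype.piFinset (fun _ : ι => Finset.range (B + 1))} := by
    refine Set.Finite.of_finite_image (f := Subtype.val) ?_ Subtype.val_injective.injOn
    refine (Finset.finite_toSet
      (Fintype.piFinset (fun _ : ι => Finset.range (B + 1))).powerset).subset ?_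
    rintro _ ⟨F, hF, rfl⟩
    exact Finset.mem_coe.2 (Finset.mem_powerset.2 hF)
  refine hfin.subset ?_
  intro F hFbig
  by_contra hnot
  apply hFbig
  have hlarge : F.1.card * (N * ∑ d : D, ∑ k, (d : ι → ℕ) k) <
      ∑ i : F.1, ∑ k, (i : ι → ℕ) k := by
    rw [F.2.2]
    simp only [Set.mem_setOf_eq, Finset.subset_iff, Fintype.mem_piFinset, Finset.mem_range] at hnot
    push Not at hnot
    obtain ⟨x, hx, k, hk⟩ := hnot
    have h1 : x k ≤ ∑ k, x k := Finset.single_le_sum (fun _ _ => Nat.zero_le _) (Finset.mem_univ k)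
    have h2 : ∑ k, x k ≤ ∑ i : F.1, ∑ k, (i : ι → ℕ) k :=
      Finset.single_le_sum (f := fun i : F.1 => ∑ k, (i : ι → ℕ) k)
        (fun _ _ => Nat.zero_le _) (Finset.mem_univ (⟨x, hx⟩ : F.1))
    omega
  have hle : ‖detA F.1‖ ≤ ε / 2 := by
    subst hdetA
    exact det_bound hna p m π D γ hγ F.1 _ (half_pos hε).le
      (det_small hna p m hp hm hpnorm π hπ D (ε / 2) N hN F.1 hlarge)
  rw [dist_zero_right, norm_norm]
  linarith
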